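/- arXiv:2210.02628 — 3 statements merged into one kernel-verified Lean document; each statement's English description precedes it below -/
import Mathlib

section
/- Let X be a pseudometric space, let m ≥ 1 be a natural number, and let v : ZMod (2m) → X. Define TSP*(v) as the minimum over all permutations σ of ZMod (2m) of ∑_{j ∈ ZMod(2m)} dist(v(σ j), v(σ(j+1))). If the tour through v satisfies the Christofides guarantee ∑_{j ∈ ZMod(2m)} dist(v j, v(j+1)) ≤ (3/2) · TSP*(v), then the total cost of the approximation algorithm's output satisfies ∑_{i=0}^{m-1} dist(v(2i), v(2i+2)) + ∑_{i=0}^{m-1} dist(v(2i+1), v(2i+3)) + min(∑_{i=0}^{m-1} dist(v(2i), v(2i+1)), ∑_{i=0}^{m-1} dist(v(2i+1), v(2i+2))) ≤ (15/4) · TSP*(v). -/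
/-- A sum over `ZMod n` is the sum over the representatives `0, …, n - 1`. -/
theorem ZMod.sum_eq_sum_range_natCast {M : Type*} [AddCommMonoid M] (n : ℕ) [NeZero n]
    (f : ZMod n → M) : ∑ j, f j = ∑ k ∈ Finset.range n, f k := by
  refine Finset.sum_nbij' ZMod.val (fun k : ℕ => (k : ZMod n)) ?_ ?_ ?_ ?_ ?_
  · exact fun j _ => Finset.mem_range.2 (ZMod.val_lt j)
  · simp
  · simp
  · exact fun k hk => ZMod.val_cast_of_lt (Finset.mem_range.1 hk)
  · simp

theorem Finset.sum_range_two_mul_eq_add {M : Type*} [AddCommMonoid M] (f : ℕ → M) (m : ℕ) :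
    ∑ k ∈ Finset.range (2 * m), f k =
      ∑ i ∈ Finset.range m, f (2 * i) + ∑ i ∈ Finset.range m, f (2 * i + 1) := by
  induction m with
  | zero => simp
  | succ m ih =>
    rw [Nat.mul_succ, Finset.sum_range_succ, Finset.sum_range_succ, ih,
      Finset.sum_range_succ, Finset.sum_range_succ]
    abel

theorem Finset.sum_range_succ_eq_sum_range {M : Type*} [AddCommGroup M] (f : ℕ → M) {m : ℕ}
    (h : f m = f 0) : ∑ i ∈ Finset.range m, f (i + 1) = ∑ i ∈ Finset.range m, f i :=
  add_right_cancel (b := f 0) <| by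
    rw [← Finset.sum_range_succ', Finset.sum_range_succ, h]


/-- If the tour `v` satisfies the Christofides guarantee
`Cost(T) ≤ (3/2)·TSP*(v)`, where `TSP*(v)` is the minimum cyclic tour cost over
all permutations of `ZMod (2m)`, then the approximation algorithm's output
costs at most `(15/4)·TSP*(v)`. -/
theorem approx_output_cost_le_tsp {X : Type*} [PseudoMetricSpace X]
    (m : ℕ) [NeZero m] (hm : 1 ≤ m) (v : ZMod (2 * m) → X)
    (hchris : ∑ j : ZMod (2 * m), dist (v j) (v (j + 1)) ≤
      (3 / 2) * ⨅ σ : Equiv.Perm (ZMod (2 * m)),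
        ∑ j : ZMod (2 * m), dist (v (σ j)) (v (σ (j + 1)))) :
    ∑ i ∈ Finset.range m, dist (v (2 * i)) (v (2 * i + 2)) +
      ∑ i ∈ Finset.range m, dist (v (2 * i + 1)) (v (2 * i + 3)) +
      min (∑ i ∈ Finset.range m, dist (v (2 * i)) (v (2 * i + 1)))
          (∑ i ∈ Finset.range m, dist (v (2 * i + 1)) (v (2 * i + 2))) ≤
      (15 / 4) * ⨅ σ : Equiv.Perm (ZMod (2 * m)),
        ∑ j : ZMod (2 * m), dist (v (σ j)) (v (σ (j + 1))) := by
  have hsplit : ∑ j : ZMod (2 * m), dist (v j) (v (j + 1)) =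
      ∑ i ∈ Finset.range m, dist (v (2 * i)) (v (2 * i + 1)) +
        ∑ i ∈ Finset.range m, dist (v (2 * i + 1)) (v (2 * i + 2)) := by
    rw [ZMod.sum_eq_sum_range_natCast, Finset.sum_range_two_mul_eq_add]
    push_cast
    simp only [add_assoc, one_add_one_eq_two]
  have hshift : ∑ i ∈ Finset.range m, dist (v (2 * i + 2)) (v (2 * i + 3)) =
      ∑ i ∈ Finset.range m, dist (v (2 * i)) (v (2 * i + 1)) := by
    have hzero : (2 : ZMod (2 * m)) * m = 0 := by exact_mod_cast ZMod.natCast_self (2 * m)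
    rw [← Finset.sum_range_succ_eq_sum_range
      (fun i : ℕ => dist (v (2 * i)) (v (2 * i + 1))) (by simp [hzero])]
    refine Finset.sum_congr rfl fun i _ => ?_
    push_cast
    congr 2 <;> ring
  have heven : ∑ i ∈ Finset.range m, dist (v (2 * i)) (v (2 * i + 2)) ≤
      ∑ i ∈ Finset.range m, dist (v (2 * i)) (v (2 * i + 1)) +
        ∑ i ∈ Finset.range m, dist (v (2 * i + 1)) (v (2 * i + 2)) := by
    rw [← Finset.sum_add_distrib]
    exact Finset.sum_le_sum fun i _ => dist_triangle _ _ _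
  have hodd : ∑ i ∈ Finset.range m, dist (v (2 * i + 1)) (v (2 * i + 3)) ≤
      ∑ i ∈ Finset.range m, dist (v (2 * i + 1)) (v (2 * i + 2)) +
        ∑ i ∈ Finset.range m, dist (v (2 * i)) (v (2 * i + 1)) := by
    rw [← hshift, ← Finset.sum_add_distrib]
    exact Finset.sum_le_sum fun i _ => dist_triangle _ _ _
  rw [hsplit] at hchris
  have hmin_left := min_le_left (∑ i ∈ Finset.range m, dist (v (2 * i)) (v (2 * i + 1)))
    (∑ i ∈ Finset.range m, dist (v (2 * i + 1)) (v (2 * i + 2)))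
  have hmin_right := min_le_right (∑ i ∈ Finset.range m, dist (v (2 * i)) (v (2 * i + 1)))
    (∑ i ∈ Finset.range m, dist (v (2 * i + 1)) (v (2 * i + 2)))
  linarith
end

section
/- Let X be a pseudometric space, let m ≥ 2 be a natural number, and let a, b : Fin m → X, with combined enumeration p : Fin (2m) → X given by p i = a i for i < m and p i = b (i − m) for i ≥ m. Define TSP*(p) as the minimum over all permutations σ of ZMod (2m) of ∑_{j ∈ ZMod(2m)} dist(p(σ j), p(σ(j+1))), and define Matching*(p) as the minimum over all fixed-point-free involutions τ of Fin (2m) of (1/2) · ∑_{i ∈ Fin(2m)} dist(p i, p(τ i)). Then the feasible-solution cost satisfies F(a,b) ≥ TSP*(p) + Matching*(p). (The cost of an optimal solution is lower-bounded by the optimal TSP cost plus the minimum-weight perfect matching cost over the 2m targets.) -/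
/-- Cost of a feasible two-vehicle solution: both cyclic vehicle tours plus the
communication links `(a i, b i)`. -/
noncomputable def feasibleCost {X : Type*} [PseudoMetricSpace X] {m : ℕ}
    (hm : 2 ≤ m) (a b : Fin m → X) : ℝ :=
  (∑ i : Fin (m - 1), dist (a ⟨i.1, by have := i.2; omega⟩)
      (a ⟨i.1 + 1, by have := i.2; omega⟩)) +
    dist (a ⟨m - 1, by omega⟩) (a ⟨0, by omega⟩) +
  (∑ i : Fin (m - 1), dist (b ⟨i.1, by have := i.2; omega⟩)
      (b ⟨i.1 + 1, by have := i.2; omega⟩)) +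
    dist (b ⟨m - 1, by omega⟩) (b ⟨0, by omega⟩) +
  ∑ i : Fin m, dist (a i) (b i)

/-- `TSP*(p)`: the optimal cyclic single-vehicle tour cost over the points
`p : Fin n → X`, the minimum over all permutations `σ` of `ZMod n` of
`∑_{j ∈ ZMod n} dist(p(σ j), p(σ(j+1)))`. -/
noncomputable def tspStar {X : Type*} [PseudoMetricSpace X] {n : ℕ} [NeZero n]
    (p : Fin n → X) : ℝ :=
  ⨅ σ : Equiv.Perm (ZMod n),
    ∑ j : ZMod n, dist (p ⟨(σ j).val, ZMod.val_lt _⟩)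
      (p ⟨(σ (j + 1)).val, ZMod.val_lt _⟩)

/-- `Matching*(p)`: the minimum-weight perfect-matching cost of the points
`p : Fin n → X`, the minimum over all fixed-point-free involutions `τ` of
`Fin n` of `(1/2) · ∑ i, dist(p i, p (τ i))`. -/
noncomputable def matchingStar {X : Type*} [PseudoMetricSpace X] {n : ℕ}
    (p : Fin n → X) : ℝ :=
  ⨅ τ : {f : Fin n → Fin n // Function.Involutive f ∧ ∀ i, f i ≠ i},
    (1 / 2) * ∑ i : Fin n, dist (p i) (p (τ.1 i))

/-- The optimal tour cost is at most the cost of any tour, given as a sequence `q` of points. -/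
theorem tspStar_le_sum_range {X : Type*} [PseudoMetricSpace X] {n : ℕ} [NeZero n]
    (p : Fin n → X) (s : Equiv.Perm (Fin n)) (q : ℕ → X) (hq : ∀ i : Fin n, q i = p (s i)) :
    tspStar p ≤ ∑ i ∈ Finset.range (n - 1), dist (q i) (q (i + 1)) + dist (q (n - 1)) (q 0) := by
  obtain _ | k := n
  · exact absurd rfl (NeZero.ne 0)
  refine (ciInf_le (Set.finite_range _).bddBelow (s : Equiv.Perm (ZMod (k + 1)))).trans
    (le_of_eq ?_)
  change ∑ j : Fin (k + 1), dist (p (s j)) (p (s (j + 1))) = _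
  simp only [← hq]
  rw [Fin.sum_univ_castSucc, Nat.add_sub_cancel, Finset.sum_range]
  simp

/-- The optimal matching cost is at most the cost of any perfect matching, given by a
fixed-point-free involution `t` of `{0, …, n - 1}`. -/
theorem matchingStar_le_sum_range {X : Type*} [PseudoMetricSpace X] {n : ℕ}
    (p : Fin n → X) (q : ℕ → X) (hq : ∀ i : Fin n, q i = p i) (t : ℕ → ℕ)
    (ht : ∀ i < n, t i < n) (ht_inv : ∀ i < n, t (t i) = i) (ht_ne : ∀ i < n, t i ≠ i) :
    matchingStar p ≤ (1 / 2) * ∑ i ∈ Finset.range n, dist (q i) (q (t i)) := by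
  refine (ciInf_le (Set.finite_range _).bddBelow
    ⟨fun i : Fin n => ⟨t i, ht i i.2⟩, fun i => Fin.ext (ht_inv i i.2),
      fun i h => ht_ne i i.2 (congrArg Fin.val h)⟩).trans (le_of_eq ?_)
  simp only [Finset.sum_range, ← hq]

/-- The tour `a 0, …, a (m - 1), b (m - 1), …, b 0` on the combined index set, as a map. -/
def reflectUpperHalf (m : ℕ) (i : Fin (2 * m)) : Fin (2 * m) :=
  ⟨if i.1 < m then i.1 else 3 * m - 1 - i.1, by have := i.2; split <;> omega⟩

theorem reflectUpperHalf_involutive (m : ℕ) : Function.Involutive (reflectUpperHalf m) := by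
  intro i
  have := i.2
  ext
  simp only [reflectUpperHalf]
  split_ifs <;> omega

/-- The perfect matching complementary to the tour `a 0, …, a (m - 1), b (m - 1), …, b 0`: the
closing edges of both vehicle tours and the inner communication links. -/
def complementaryMatching (m i : ℕ) : ℕ :=
  if i = 0 then m - 1 else if i = m - 1 then 0 else
    if i = m then 2 * m - 1 else if i = 2 * m - 1 then m else
      if i < m then i + m else i - m

theorem complementaryMatching_lt {m i : ℕ} (hi : i < 2 * m) :
    complementaryMatching m i < 2 * m := by
  unfold complementaryMatching
  split_ifs <;> omega

theorem complementaryMatching_ne {m i : ℕ} (hm : 2 ≤ m) :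
    complementaryMatching m i ≠ i := by
  unfold complementaryMatching
  split_ifs <;> omega

theorem complementaryMatching_zero (m : ℕ) : complementaryMatching m 0 = m - 1 :=
  if_pos rfl

theorem complementaryMatching_pred (m : ℕ) : complementaryMatching m (m - 1) = 0 := by
  unfold complementaryMatching
  split_ifs <;> omega

theorem complementaryMatching_self {m : ℕ} (hm : 0 < m) :
    complementaryMatching m m = 2 * m - 1 := by
  unfold complementaryMatching
  split_ifs <;> omega

theorem complementaryMatching_two_mul_pred {m : ℕ} (hm : 2 ≤ m) :
    complementaryMatching m (2 * m - 1) = m := by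
  unfold complementaryMatching
  split_ifs <;> omega

theorem complementaryMatching_lower {m i : ℕ} (h0 : 0 < i) (hi : i < m - 1) :
    complementaryMatching m i = i + m := by
  unfold complementaryMatching
  split_ifs <;> omega

theorem complementaryMatching_upper {m i : ℕ} (h0 : 0 < i) (hi : i < m - 1) :
    complementaryMatching m (i + m) = i := by
  unfold complementaryMatching
  split_ifs <;> omega

theorem complementaryMatching_complementaryMatching {m i : ℕ} (hm : 2 ≤ m) (hi : i < 2 * m) :
    complementaryMatching m (complementaryMatching m i) = i := by
  obtain rfl | h0 := Nat.eq_zero_or_pos i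
  · rw [complementaryMatching_zero, complementaryMatching_pred]
  obtain h | rfl | h := lt_trichotomy i (m - 1)
  · rw [complementaryMatching_lower h0 h, complementaryMatching_upper h0 h]
  · rw [complementaryMatching_pred, complementaryMatching_zero]
  obtain rfl | h1 := eq_or_ne i m
  · rw [complementaryMatching_self (by omega), complementaryMatching_two_mul_pred hm]
  obtain rfl | h2 := eq_or_ne i (2 * m - 1)
  · rw [complementaryMatching_two_mul_pred hm, complementaryMatching_self (by omega)]
  obtain ⟨j, rfl⟩ : ∃ j, i = j + m := ⟨i - m, by omega⟩
  rw [complementaryMatching_upper (by omega) (by omega),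
    complementaryMatching_lower (by omega) (by omega)]

/-- For the combined enumeration `p : Fin (2m) → X` of the
targets (`p i = a i` for `i < m` and `p i = b (i - m)` for `i ≥ m`), the cost of
any feasible two-vehicle solution is lower-bounded by the optimal TSP cost plus
the minimum-weight perfect-matching cost: `F(a,b) ≥ TSP*(p) + Matching*(p)`. -/
theorem feasibleCost_ge_tspStar_add_matchingStar {X : Type*} [PseudoMetricSpace X]
    (m : ℕ) [NeZero m] (hm : 2 ≤ m) (a b : Fin m → X) (p : Fin (2 * m) → X)
    (hp1 : ∀ i : Fin (2 * m), ∀ h : i.1 < m, p i = a ⟨i.1, h⟩)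
    (hp2 : ∀ i : Fin (2 * m), ∀ _h : m ≤ i.1, p i = b ⟨i.1 - m, by have := i.2; omega⟩) :
    feasibleCost hm a b ≥ tspStar p + matchingStar p := by
  obtain ⟨l, rfl⟩ : ∃ l, m = l + 2 := ⟨m - 2, by omega⟩
  set A : ℕ → X := fun i => a (Fin.ofNat (l + 2) i) with hA
  set B : ℕ → X := fun i => b (Fin.ofNat (l + 2) i) with hB
  have hAa : ∀ i (h : i < l + 2), a ⟨i, h⟩ = A i := fun i h => by
    simp [hA, Fin.ofNat, Nat.mod_eq_of_lt h]
  have hBb : ∀ i (h : i < l + 2), b ⟨i, h⟩ = B i := fun i h => by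
    simp [hB, Fin.ofNat, Nat.mod_eq_of_lt h]
  have hcost : feasibleCost hm a b =
      ∑ i ∈ Finset.range (l + 1), dist (A i) (A (i + 1)) + dist (A (l + 1)) (A 0) +
      ∑ i ∈ Finset.range (l + 1), dist (B i) (B (i + 1)) + dist (B (l + 1)) (B 0) +
      ∑ i ∈ Finset.range (l + 2), dist (A i) (B i) := by
    simp only [feasibleCost, hAa, hBb, Finset.sum_range]
    rfl
  set P : ℕ → X := fun i => if i < l + 2 then A i else B (i - (l + 2)) with hP
  have hPp : ∀ i : Fin (2 * (l + 2)), P i = p i := fun i => by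
    by_cases h : i.1 < l + 2
    · simp only [hP, if_pos h, hp1 i h, hAa]
    · simp only [hP, if_neg h, hp2 i (not_lt.mp h), hBb]
  have hPA : ∀ i < l + 2, P i = A i := fun i h => if_pos h
  have hPB : ∀ i, P (l + 2 + i) = B i := fun i => by simp [hP]
  have htour : tspStar p ≤ ∑ i ∈ Finset.range (l + 1), dist (A i) (A (i + 1)) +
      dist (A (l + 1)) (B (l + 1)) + ∑ i ∈ Finset.range (l + 1), dist (B i) (B (i + 1)) +
      dist (B 0) (A 0) := by
    refine (tspStar_le_sum_range p (reflectUpperHalf_involutive (l + 2)).toPerm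
      (fun i => if i < l + 2 then A i else B (2 * l + 3 - i)) fun i => ?_).trans (le_of_eq ?_)
    · rw [Function.Involutive.coe_toPerm, ← hPp]
      have := i.2
      by_cases h : i.1 < l + 2
      · simp [reflectUpperHalf, h, hP]
      · have h2 : ¬ 3 * (l + 2) - 1 - i.1 < l + 2 := by omega
        simp only [reflectUpperHalf, h, hP, h2, if_false]
        congr 1
        omega
    · rw [show 2 * (l + 2) - 1 = (l + 1) + 1 + (l + 1) by omega, Finset.sum_range_add,
        Finset.sum_range_succ]
      rw [← Finset.sum_range_reflect (fun i => dist (B i) (B (i + 1)))]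
      congr 1
      · congr 1
        · congr 1
          · refine Finset.sum_congr rfl fun i hi => ?_
            have := Finset.mem_range.mp hi
            rw [if_pos (by omega), if_pos (by omega)]
          · rw [if_pos (by omega), if_neg (by omega)]
            congr 2
            omega
        · refine Finset.sum_congr rfl fun i hi => ?_
          have := Finset.mem_range.mp hi
          rw [if_neg (by omega), if_neg (by omega), dist_comm]
          congr 2 <;> omega
      · rw [if_neg (by omega), if_pos (by omega)]
        congr 2
        omega
  have hmatch : matchingStar p ≤ dist (A (l + 1)) (A 0) + dist (B (l + 1)) (B 0) +
      ∑ i ∈ Finset.range l, dist (A (i + 1)) (B (i + 1)) := by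
    refine (matchingStar_le_sum_range p P hPp (complementaryMatching (l + 2))
      (fun i hi => complementaryMatching_lt hi)
      (fun i hi => complementaryMatching_complementaryMatching hm hi)
      (fun _ _ => complementaryMatching_ne hm)).trans (le_of_eq ?_)
    have h0 : complementaryMatching (l + 2) 0 = l + 1 := complementaryMatching_zero _
    have h1 : complementaryMatching (l + 2) (l + 1) = 0 := complementaryMatching_pred (l + 2)
    have h2 : complementaryMatching (l + 2) (l + 2 + 0) = l + 2 + (l + 1) := by
      rw [add_zero, complementaryMatching_self (by omega)]
      omega
    have h3 : complementaryMatching (l + 2) (l + 2 + (l + 1)) = l + 2 + 0 := by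
      rw [show l + 2 + (l + 1) = 2 * (l + 2) - 1 by omega, complementaryMatching_two_mul_pred hm,
        add_zero]
    have h4 : ∀ i ∈ Finset.range l,
        dist (P (i + 1)) (P (complementaryMatching (l + 2) (i + 1))) =
          dist (A (i + 1)) (B (i + 1)) := fun i hi => by
      have hi := Finset.mem_range.mp hi
      have : complementaryMatching (l + 2) (i + 1) = l + 2 + (i + 1) := by
        rw [complementaryMatching_lower (by omega) (by omega), add_comm]
      rw [this, hPA _ (by omega), hPB]
    have h5 : ∀ i ∈ Finset.range l,
        dist (P (l + 2 + (i + 1))) (P (complementaryMatching (l + 2) (l + 2 + (i + 1)))) =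
          dist (A (i + 1)) (B (i + 1)) := fun i hi => by
      have hi := Finset.mem_range.mp hi
      have : complementaryMatching (l + 2) (l + 2 + (i + 1)) = i + 1 := by
        rw [add_comm (l + 2), complementaryMatching_upper (by omega) (by omega)]
      rw [this, hPB, hPA _ (by omega), dist_comm]
    rw [two_mul (l + 2), Finset.sum_range_add, Finset.sum_range_succ, Finset.sum_range_succ',
      Finset.sum_range_succ, Finset.sum_range_succ', Finset.sum_congr rfl h4,
      Finset.sum_congr rfl h5, h0, h1, h2, h3, hPA _ (by omega), hPA _ (by omega), hPB, hPB,
      dist_comm (A 0), dist_comm (B 0)]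
    ring
  rw [Finset.sum_range_succ' (fun i => dist (A i) (B i)),
    Finset.sum_range_succ (fun i => dist (A (i + 1)) (B (i + 1))), dist_comm (A 0) (B 0)] at hcost
  linarith
end

section
/- Let X be a pseudometric space, let m ≥ 2 be a natural number, and let a, b : Fin m → X, with combined enumeration p : Fin (2m) → X given by p i = a i for i < m and p i = b (i − m) for i ≥ m. Define TSP*(p) as the minimum over all permutations σ of ZMod (2m) of ∑_{j ∈ ZMod(2m)} dist(p(σ j), p(σ(j+1))). Suppose v : ZMod (2m) → X is a closed tour visiting the same targets, i.e., v = p ∘ ρ for some bijection ρ : ZMod (2m) → Fin (2m), and suppose v satisfies the Christofides guarantee ∑_{j ∈ ZMod(2m)} dist(v j, v(j+1)) ≤ (3/2) · TSP*(p). Then the approximation algorithm's output built from v satisfies ∑_{i=0}^{m-1} dist(v(2i), v(2i+2)) + ∑_{i=0}^{m-1} dist(v(2i+1), v(2i+3)) + min(∑_{i=0}^{m-1} dist(v(2i), v(2i+1)), ∑_{i=0}^{m-1} dist(v(2i+1), v(2i+2))) ≤ (15/4) · F(a,b); in particular the algorithm is a 3.75-approximation relative to any feasible solution, hence relative to the optimal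 one. -/
theorem ZMod.sum_eq_sum_range {M : Type*} [AddCommMonoid M] (n : ℕ) [NeZero n]
    (f : ZMod n → M) : ∑ j : ZMod n, f j = ∑ i ∈ Finset.range n, f (i : ZMod n) := by
  refine Finset.sum_bij' (fun j _ => j.val) (fun i _ => (i : ZMod n)) ?_ ?_ ?_ ?_ ?_
  · intro j _
    exact Finset.mem_range.2 (ZMod.val_lt j)
  · intro i _
    exact Finset.mem_univ _
  · intro j _
    exact ZMod.natCast_zmod_val j
  · intro i hi
    exact ZMod.val_cast_of_lt (Finset.mem_range.1 hi)
  · intro j _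
    rw [ZMod.natCast_zmod_val]

theorem Finset.sum_range_two_mul {M : Type*} [AddCommMonoid M] (f : ℕ → M) (m : ℕ) :
    ∑ i ∈ Finset.range (2 * m), f i =
      ∑ i ∈ Finset.range m, f (2 * i) + ∑ i ∈ Finset.range m, f (2 * i + 1) := by
  rw [← Finset.sum_add_distrib]
  induction m with
  | zero => simp
  | succ k ih =>
    rw [Nat.mul_succ, Finset.sum_range_succ, Finset.sum_range_succ, ih,
      Finset.sum_range_succ, add_assoc]

/-- The two shortcut tours and the cheaper alternating edge set of a closed tour cost
at most `5/2` times the tour. -/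
theorem shortcut_add_alternating_le {X : Type*} [PseudoMetricSpace X] (m : ℕ) [NeZero m]
    (v : ZMod (2 * m) → X) :
    ∑ i ∈ Finset.range m, dist (v (2 * i)) (v (2 * i + 2)) +
      ∑ i ∈ Finset.range m, dist (v (2 * i + 1)) (v (2 * i + 3)) +
      min (∑ i ∈ Finset.range m, dist (v (2 * i)) (v (2 * i + 1)))
          (∑ i ∈ Finset.range m, dist (v (2 * i + 1)) (v (2 * i + 2))) ≤
      (5 / 2) * ∑ j : ZMod (2 * m), dist (v j) (v (j + 1)) := by
  have hsplit : ∑ j : ZMod (2 * m), dist (v j) (v (j + 1)) =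
      ∑ i ∈ Finset.range m, dist (v (2 * i)) (v (2 * i + 1)) +
      ∑ i ∈ Finset.range m, dist (v (2 * i + 1)) (v (2 * i + 2)) := by
    rw [ZMod.sum_eq_sum_range, Finset.sum_range_two_mul]
    push_cast
    simp only [add_assoc, one_add_one_eq_two]
  have hshift : ∑ i ∈ Finset.range m, dist (v (2 * i + 2)) (v (2 * i + 3)) =
      ∑ i ∈ Finset.range m, dist (v (2 * i)) (v (2 * i + 1)) := by
    have h0 : (2 * (m : ZMod (2 * m))) = 0 := by
      exact_mod_cast ZMod.natCast_self (2 * m)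
    have h1 := Finset.sum_range_succ (fun i : ℕ => dist (v (2 * i)) (v (2 * i + 1))) m
    rw [Finset.sum_range_succ'] at h1
    simp only [h0, Nat.cast_zero, mul_zero, add_left_inj, Nat.cast_add, Nat.cast_one,
      mul_add, mul_one, add_assoc, two_add_one_eq_three] at h1
    exact h1
  have heven : ∑ i ∈ Finset.range m, dist (v (2 * i)) (v (2 * i + 2)) ≤
      ∑ i ∈ Finset.range m, dist (v (2 * i)) (v (2 * i + 1)) +
      ∑ i ∈ Finset.range m, dist (v (2 * i + 1)) (v (2 * i + 2)) := by
    rw [← Finset.sum_add_distrib]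
    exact Finset.sum_le_sum fun i _ => dist_triangle _ _ _
  have hodd : ∑ i ∈ Finset.range m, dist (v (2 * i + 1)) (v (2 * i + 3)) ≤
      ∑ i ∈ Finset.range m, dist (v (2 * i + 1)) (v (2 * i + 2)) +
      ∑ i ∈ Finset.range m, dist (v (2 * i + 2)) (v (2 * i + 3)) := by
    rw [← Finset.sum_add_distrib]
    exact Finset.sum_le_sum fun i _ => dist_triangle _ _ _
  have hmin := min_le_left (∑ i ∈ Finset.range m, dist (v (2 * i)) (v (2 * i + 1)))
    (∑ i ∈ Finset.range m, dist (v (2 * i + 1)) (v (2 * i + 2)))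
  have hmin' := min_le_right (∑ i ∈ Finset.range m, dist (v (2 * i)) (v (2 * i + 1)))
    (∑ i ∈ Finset.range m, dist (v (2 * i + 1)) (v (2 * i + 2)))
  linarith

/-- The map of `ZMod (2 * m)` fixing the residues below `m` and reversing the order of
the others. -/
def reverseUpper (m : ℕ) (j : ZMod (2 * m)) : ZMod (2 * m) :=
  if j.val < m then j else ((3 * m - 1 - j.val : ℕ) : ZMod (2 * m))

theorem val_reverseUpper (m : ℕ) [NeZero m] (j : ZMod (2 * m)) :
    (reverseUpper m j).val = if j.val < m then j.val else 3 * m - 1 - j.val := by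
  have hj := ZMod.val_lt j
  unfold reverseUpper
  split_ifs with h
  · rfl
  · exact ZMod.val_cast_of_lt (by omega)

theorem reverseUpper_involutive (m : ℕ) [NeZero m] :
    Function.Involutive (reverseUpper m) := by
  intro j
  have hj := ZMod.val_lt j
  apply ZMod.val_injective
  rw [val_reverseUpper, val_reverseUpper]
  split_ifs <;> omega

/-- The tour `a₀, …, a_{m-1}, b_{m-1}, …, b₀` costs at most as much as the feasible
solution `(a, b)`. -/
theorem tspStar_le_feasibleCost {X : Type*} [PseudoMetricSpace X]
    (m : ℕ) [NeZero m] (hm : 2 ≤ m) (a b : Fin m → X) (p : Fin (2 * m) → X)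
    (hpa : ∀ i : Fin m, p ⟨i, by omega⟩ = a i)
    (hpb : ∀ i : Fin m, p ⟨m + i, by omega⟩ = b i) :
    tspStar p ≤ feasibleCost hm a b := by
  refine (ciInf_le (Set.finite_range _).bddBelow (reverseUpper_involutive m).toPerm).trans ?_
  rw [ZMod.sum_eq_sum_range]
  simp only [Function.Involutive.coe_toPerm]
  set q : ℕ → X := fun i =>
    p ⟨(reverseUpper m (i : ZMod (2 * m))).val, ZMod.val_lt _⟩ with hq
  have hqa : ∀ i (h : i < m), q i = a ⟨i, h⟩ := by
    intro i h
    have hval : (reverseUpper m (i : ZMod (2 * m))).val = i := by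
      rw [val_reverseUpper, ZMod.val_cast_of_lt (by omega), if_pos h]
    simp only [hq, hval]
    exact hpa ⟨i, h⟩
  have hqb : ∀ i (h : i < m), q (2 * m - 1 - i) = b ⟨i, h⟩ := by
    intro i h
    have hval : (reverseUpper m ((2 * m - 1 - i : ℕ) : ZMod (2 * m))).val = m + i := by
      rw [val_reverseUpper, ZMod.val_cast_of_lt (by omega), if_neg (by omega)]
      omega
    simp only [hq, hval]
    exact hpb ⟨i, h⟩
  have hqtop : q (2 * m) = a ⟨0, by omega⟩ := by
    rw [← hqa 0 (by omega)]
    simp only [hq, ZMod.natCast_self, Nat.cast_zero]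
  have hcost : ∑ i ∈ Finset.range (2 * m), dist (q i) (q (i + 1)) ≤ feasibleCost hm a b := by
    clear_value q
    obtain ⟨k, rfl⟩ : ∃ k, m = k + 1 := ⟨m - 1, by omega⟩
    have hlen : 2 * (k + 1) = k + 1 + k + 1 := by omega
    have hA : ∑ i : Fin k, dist (a ⟨i.1, by omega⟩) (a ⟨i.1 + 1, by omega⟩) =
        ∑ i ∈ Finset.range k, dist (q i) (q (i + 1)) := by
      rw [Finset.sum_range]
      refine Finset.sum_congr rfl fun i _ => ?_
      rw [hqa i (by omega), hqa (i + 1) (by omega)]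
    have hB : ∑ i : Fin k, dist (b ⟨i.1, by omega⟩) (b ⟨i.1 + 1, by omega⟩) =
        ∑ i ∈ Finset.range k, dist (q (k + 1 + i)) (q (k + 1 + i + 1)) := by
      rw [← Finset.sum_range_reflect, Finset.sum_range]
      refine Finset.sum_congr rfl fun i _ => ?_
      have hi := i.2
      rw [← hqb i (by omega), ← hqb (i + 1) (by omega), dist_comm]
      congr 2 <;> omega
    have hlinks : dist (a ⟨k, by omega⟩) (b ⟨k, by omega⟩) +
        dist (a ⟨0, by omega⟩) (b ⟨0, by omega⟩) ≤
        ∑ i : Fin (k + 1), dist (a i) (b i) := by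
      have hne : (⟨k, by omega⟩ : Fin (k + 1)) ≠ ⟨0, by omega⟩ := by
        simp only [ne_eq, Fin.mk.injEq]
        omega
      rw [← Finset.sum_pair (f := fun i => dist (a i) (b i)) hne]
      exact Finset.sum_le_sum_of_subset_of_nonneg (Finset.subset_univ _)
        fun _ _ _ => dist_nonneg
    have hak := hqa k (by omega)
    have hbk := hqb k (by omega)
    have hb0 := hqb 0 (by omega)
    rw [show 2 * (k + 1) - 1 - k = k + 1 by omega] at hbk
    rw [show 2 * (k + 1) - 1 - 0 = k + 1 + k by omega] at hb0
    rw [hlen] at hqtop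
    rw [hlen, Finset.sum_range_succ, Finset.sum_range_add, Finset.sum_range_succ,
      hak, hbk, hb0, hqtop, ← hA, ← hB, dist_comm (b ⟨0, _⟩)]
    have hF : feasibleCost hm a b =
        ∑ i : Fin k, dist (a ⟨i.1, by omega⟩) (a ⟨i.1 + 1, by omega⟩) +
        dist (a ⟨k, by omega⟩) (a ⟨0, by omega⟩) +
        ∑ i : Fin k, dist (b ⟨i.1, by omega⟩) (b ⟨i.1 + 1, by omega⟩) +
        dist (b ⟨k, by omega⟩) (b ⟨0, by omega⟩) +
        ∑ i : Fin (k + 1), dist (a i) (b i) := rfl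
    rw [hF]
    have h1 : 0 ≤ dist (a ⟨k, by omega⟩) (a ⟨0, by omega⟩) := dist_nonneg
    have h2 : 0 ≤ dist (b ⟨k, by omega⟩) (b ⟨0, by omega⟩) := dist_nonneg
    linarith
  simpa [hq] using hcost

/-- If the closed tour `v : ZMod (2m) → X` visits the same
`2m` targets as the combined enumeration `p` of a feasible solution `(a, b)`
(i.e. `v = p ∘ ρ` for a bijection `ρ`), and `v` satisfies the Christofides
guarantee `Cost(v) ≤ (3/2)·TSP*(p)`, then the approximation algorithm's output
built from `v` (the two shortcut tours plus the cheaper alternating edge set)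
costs at most `(15/4)·F(a,b)`: the algorithm is a `3.75`-approximation relative
to any feasible solution, hence relative to the optimal one. -/
theorem approx_is_3_75_approximation {X : Type*} [PseudoMetricSpace X]
    (m : ℕ) [NeZero m] (hm : 2 ≤ m) (a b : Fin m → X) (p : Fin (2 * m) → X)
    (hp1 : ∀ i : Fin (2 * m), ∀ h : i.1 < m, p i = a ⟨i.1, h⟩)
    (hp2 : ∀ i : Fin (2 * m), ∀ _h : m ≤ i.1, p i = b ⟨i.1 - m, by have := i.2; omega⟩)
    (v : ZMod (2 * m) → X) (ρ : ZMod (2 * m) ≃ Fin (2 * m))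
    (hv : ∀ j : ZMod (2 * m), v j = p (ρ j))
    (hchris : ∑ j : ZMod (2 * m), dist (v j) (v (j + 1)) ≤ (3 / 2) * tspStar p) :
    ∑ i ∈ Finset.range m, dist (v (2 * i)) (v (2 * i + 2)) +
      ∑ i ∈ Finset.range m, dist (v (2 * i + 1)) (v (2 * i + 3)) +
      min (∑ i ∈ Finset.range m, dist (v (2 * i)) (v (2 * i + 1)))
          (∑ i ∈ Finset.range m, dist (v (2 * i + 1)) (v (2 * i + 2))) ≤
      (15 / 4) * feasibleCost hm a b := by
  have hshort := shortcut_add_alternating_le m v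
  have htsp := tspStar_le_feasibleCost m hm a b p (fun i => hp1 _ i.2)
    (fun i => by rw [hp2 _ (Nat.le_add_right m i)]; simp)
  linarith
end
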